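/- Let G be an S_{3,3}-free simple graph and let u, v be adjacent vertices with d(u) ≥ 6 and d(v) ≥ 6 (a 6-6 edge). Then there are at least 5 triangles sitting on the edge uv, i.e. |N(u) ∩ N(v)| ≥ 5. -/

import Mathlib

/-- A simple graph `G` contains the double star `S_{m,l}`: there are adjacent vertices
`x, y` and disjoint sets `A ⊆ N(x) \\ {y}`, `B ⊆ N(y) \\ {x}` with `|A| = m`, `|B| = l`
and `x, y ∉ A ∪ B`. -/
def ContainsDoubleStar {V : Type*} (G : SimpleGraph V) (m l : ℕ) : Prop :=
  ∃ x y : V, ∃ A B : Finset V,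
    G.Adj x y ∧
    (∀ a ∈ A, G.Adj x a ∧ a ≠ y) ∧
    (∀ b ∈ B, G.Adj y b ∧ b ≠ x) ∧
    A.card = m ∧ B.card = l ∧ Disjoint A B ∧
    x ∉ A ∧ x ∉ B ∧ y ∉ A ∧ y ∉ B

theorem Finset.exists_disjoint_subsets_card_eq {α : Type*} [DecidableEq α] {P Q : Finset α}
    {m l : ℕ} (hP : m ≤ P.card) (hQ : l ≤ Q.card) (hPQ : m + l ≤ (P ∪ Q).card) :
    ∃ A ⊆ P, ∃ B ⊆ Q, A.card = m ∧ B.card = l ∧ Disjoint A B := by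
  rcases le_total m (P \ Q).card with h | h
  · obtain ⟨A, hA, hAm⟩ := Finset.exists_subset_card_eq h
    obtain ⟨B, hB, hBl⟩ := Finset.exists_subset_card_eq hQ
    exact ⟨A, hA.trans Finset.sdiff_subset, B, hB, hAm, hBl,
      Finset.sdiff_disjoint.mono hA hB⟩
  · obtain ⟨A, hA, hAP, hAm⟩ :=
      Finset.exists_subsuperset_card_eq (Finset.sdiff_subset (s := P) (t := Q)) h hP
    have hl : l ≤ (Q \ A).card := by
      have hsub : (P ∪ Q) \ A ⊆ Q \ A := fun x hx => by
        have := @hA x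
        simp only [Finset.mem_sdiff, Finset.mem_union] at hx this ⊢
        tauto
      have := Finset.card_le_card hsub
      have := Finset.le_card_sdiff A (P ∪ Q)
      omega
    obtain ⟨B, hB, hBl⟩ := Finset.exists_subset_card_eq hl
    exact ⟨A, hAP, B, hB.trans Finset.sdiff_subset, hAm, hBl,
      Finset.disjoint_sdiff.mono_right hB⟩

theorem stmt_3 {V : Type*} [Fintype V] [DecidableEq V] (G : SimpleGraph V)
    [DecidableRel G.Adj] (hfree : ¬ ContainsDoubleStar G 3 3) (u v : V)
    (huv : G.Adj u v) (hu : 6 ≤ G.degree u) (hv : 6 ≤ G.degree v) :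
    5 ≤ (G.neighborFinset u ∩ G.neighborFinset v).card := by
  by_contra! hlt
  set P := (G.neighborFinset u).erase v with hP
  set Q := (G.neighborFinset v).erase u with hQ
  have hPc : P.card = G.degree u - 1 := by
    rw [hP, Finset.card_erase_of_mem (by simpa using huv), G.card_neighborFinset_eq_degree]
  have hQc : Q.card = G.degree v - 1 := by
    rw [hQ, Finset.card_erase_of_mem (by simpa using huv.symm), G.card_neighborFinset_eq_degree]
  have hI : (P ∩ Q).card ≤ (G.neighborFinset u ∩ G.neighborFinset v).card :=
    Finset.card_le_card
      (Finset.inter_subset_inter (Finset.erase_subset _ _) (Finset.erase_subset _ _))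
  have hU := Finset.card_union_add_card_inter P Q
  obtain ⟨A, hA, B, hB, hAc, hBc, hAB⟩ :=
    Finset.exists_disjoint_subsets_card_eq (P := P) (Q := Q) (m := 3) (l := 3)
      (by omega) (by omega) (by omega)
  have hA' : ∀ a ∈ A, G.Adj u a ∧ a ≠ v := fun a ha => by
    simpa [hP, and_comm] using hA ha
  have hB' : ∀ b ∈ B, G.Adj v b ∧ b ≠ u := fun b hb => by
    simpa [hQ, and_comm] using hB hb
  exact hfree ⟨u, v, A, B, huv, hA', hB', hAc, hBc, hAB,
    fun h => G.irrefl (hA' u h).1, fun h => (hB' u h).2 rfl,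
    fun h => (hA' v h).2 rfl, fun h => G.irrefl (hB' v h).1⟩
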